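/- arXiv:2507.07538 — 9 statements merged into one kernel-verified Lean document; each statement's English description precedes it below -/
import Mathlib

section
/- Let H be a real inner product space, let p ∈ (1,2) and ρ > 0, and define U_ρ : H → ℝ by U_ρ(x) = (‖x‖² + ρ)^{p/2}. Then U_ρ is twice Fréchet differentiable, its second derivative at x is the continuous bilinear form (h,k) ↦ p (‖x‖² + ρ)^{p/2 − 1} ⟨h,k⟩ + p(p−2) (‖x‖² + ρ)^{p/2 − 2} ⟨x,h⟩⟨x,k⟩, and for every x ≠ 0 its operator norm satisfies ‖D²U_ρ(x)‖ ≤ p(3−p) ‖x‖^{p−2}. -/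
open RealInnerProductSpace

theorem hasFDerivAt_norm_sq_add_rpow {H : Type*} [NormedAddCommGroup H]
    [InnerProductSpace ℝ H] {ρ : ℝ} (hρ : 0 < ρ) (s : ℝ) (x : H) :
    HasFDerivAt (fun y : H => (‖y‖ ^ 2 + ρ) ^ s)
      ((s * (‖x‖ ^ 2 + ρ) ^ (s - 1)) • (2 : ℝ) • innerSL ℝ x) x := by
  have hA : 0 < ‖x‖ ^ 2 + ρ := by positivity
  have h : HasFDerivAt (fun y : H => ‖y‖ ^ 2 + ρ) ((2 : ℝ) • innerSL ℝ x) x := by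
    simpa [two_smul] using (hasStrictFDerivAt_norm_sq x).hasFDerivAt.add_const ρ
  exact h.rpow_const (Or.inl hA.ne')

theorem norm_sq_add_rpow_le {E : Type*} [NormedAddCommGroup E] {ρ : ℝ} (hρ : 0 ≤ ρ)
    {s : ℝ} (hs : s ≤ 0) {x : E} (hx : x ≠ 0) :
    (‖x‖ ^ 2 + ρ) ^ s ≤ ‖x‖ ^ (2 * s) := by
  have hx' : 0 < ‖x‖ := norm_pos_iff.mpr hx
  calc (‖x‖ ^ 2 + ρ) ^ s ≤ (‖x‖ ^ 2) ^ s :=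
        Real.rpow_le_rpow_of_nonpos (by positivity) (by linarith) hs
    _ = ‖x‖ ^ (2 * s) := by
        rw [Real.rpow_mul hx'.le, Real.rpow_two]

theorem norm_sq_add_rpow_sub_one_mul_norm_sq_le {E : Type*} [NormedAddCommGroup E]
    {ρ : ℝ} (hρ : 0 < ρ) (s : ℝ) (x : E) :
    (‖x‖ ^ 2 + ρ) ^ (s - 1) * ‖x‖ ^ 2 ≤ (‖x‖ ^ 2 + ρ) ^ s := by
  have hA : 0 < ‖x‖ ^ 2 + ρ := by positivity
  calc (‖x‖ ^ 2 + ρ) ^ (s - 1) * ‖x‖ ^ 2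
      ≤ (‖x‖ ^ 2 + ρ) ^ (s - 1) * (‖x‖ ^ 2 + ρ) := by gcongr; linarith
    _ = (‖x‖ ^ 2 + ρ) ^ s := by
        rw [Real.rpow_sub_one hA.ne', div_mul_cancel₀ _ hA.ne']

/-- For a real inner product space `H`, `p ∈ (1,2)`, `ρ > 0`, the function
`U_ρ(x) = (‖x‖² + ρ)^{p/2}` is twice Fréchet differentiable: its first derivative at `x` is
`h ↦ p (‖x‖² + ρ)^{p/2-1} ⟪x,h⟫` and its second derivative at `x` is the continuous bilinear
form `(h,k) ↦ p (‖x‖² + ρ)^{p/2-1} ⟪h,k⟫ + p(p-2) (‖x‖² + ρ)^{p/2-2} ⟪x,h⟫⟪x,k⟫`; moreover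
for `x ≠ 0` the operator norm of the second derivative is at most `p(3-p)‖x‖^{p-2}`. -/
theorem stmt_1 {H : Type*} [NormedAddCommGroup H] [InnerProductSpace ℝ H]
    (p ρ : ℝ) (hp : p ∈ Set.Ioo (1 : ℝ) 2) (hρ : 0 < ρ)
    (U : H → ℝ) (hU : ∀ x, U x = (‖x‖ ^ 2 + ρ) ^ (p / 2))
    (D : H → H →L[ℝ] ℝ)
    (hD : ∀ x h, D x h = p * (‖x‖ ^ 2 + ρ) ^ (p / 2 - 1) * ⟪x, h⟫)
    (B : H → H →L[ℝ] H →L[ℝ] ℝ)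
    (hB : ∀ x h k, B x h k =
      p * (‖x‖ ^ 2 + ρ) ^ (p / 2 - 1) * ⟪h, k⟫
        + p * (p - 2) * (‖x‖ ^ 2 + ρ) ^ (p / 2 - 2) * ⟪x, h⟫ * ⟪x, k⟫)
    (x : H) :
    HasFDerivAt U (D x) x ∧ HasFDerivAt D (B x) x ∧
      (x ≠ 0 → ‖B x‖ ≤ p * (3 - p) * ‖x‖ ^ (p - 2)) := by
  obtain ⟨hp1, hp2⟩ := hp
  refine ⟨?_, ?_, fun hx => ?_⟩
  · rw [funext hU]
    convert hasFDerivAt_norm_sq_add_rpow hρ (p / 2) x using 1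
    ext h
    simp only [hD, smul_apply, innerSL_apply_apply, smul_eq_mul]
    ring
  · obtain ⟨L, hL⟩ : ∃ L : H →L[ℝ] H →L[ℝ] ℝ, ∀ h k, L h k = ⟪h, k⟫ :=
      ⟨innerSL ℝ, fun _ _ => rfl⟩
    have hD' : D = fun y => (p * (‖y‖ ^ 2 + ρ) ^ (p / 2 - 1)) • L y := by
      ext y h
      simp [hD, hL]
    rw [hD']
    refine (((hasFDerivAt_norm_sq_add_rpow hρ (p / 2 - 1) x).const_mul p).smul
      L.hasFDerivAt).congr_fderiv ?_
    ext h k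
    simp only [hB, add_apply, smul_apply, ContinuousLinearMap.smulRight_apply,
      innerSL_apply_apply, smul_eq_mul, hL]
    rw [show p / 2 - 1 - 1 = p / 2 - 2 by ring]
    ring
  · have h1 : (‖x‖ ^ 2 + ρ) ^ (p / 2 - 1) ≤ ‖x‖ ^ (p - 2) := by
      convert norm_sq_add_rpow_le hρ.le (s := p / 2 - 1) (by linarith) hx using 2
      ring
    have h2 : (‖x‖ ^ 2 + ρ) ^ (p / 2 - 2) * ‖x‖ ^ 2 ≤ (‖x‖ ^ 2 + ρ) ^ (p / 2 - 1) := by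
      convert norm_sq_add_rpow_sub_one_mul_norm_sq_le hρ (p / 2 - 1) x using 3
      ring
    have h3p : 0 ≤ p * (3 - p) := mul_nonneg (by linarith) (by linarith)
    have h2p : 0 ≤ p * (2 - p) := mul_nonneg (by linarith) (by linarith)
    refine ContinuousLinearMap.opNorm_le_bound₂ _ (by positivity) fun h k => ?_
    rw [hB, Real.norm_eq_abs]
    set a := (‖x‖ ^ 2 + ρ) ^ (p / 2 - 1)
    set b := (‖x‖ ^ 2 + ρ) ^ (p / 2 - 2)
    have ha0 : 0 ≤ a := by positivity
    have hb0 : 0 ≤ b := by positivity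
    have hpa : 0 ≤ p * a := mul_nonneg (by linarith) ha0
    calc |p * a * ⟪h, k⟫ + p * (p - 2) * b * ⟪x, h⟫ * ⟪x, k⟫|
        = |p * a * ⟪h, k⟫ - p * (2 - p) * b * (⟪x, h⟫ * ⟪x, k⟫)| := by congr 1; ring
      _ ≤ |p * a * ⟪h, k⟫| + |p * (2 - p) * b * (⟪x, h⟫ * ⟪x, k⟫)| := abs_sub _ _
      _ = p * a * |⟪h, k⟫| + p * (2 - p) * b * (|⟪x, h⟫| * |⟪x, k⟫|) := by
          rw [abs_mul, abs_mul (p * (2 - p) * b), abs_mul ⟪x, h⟫, abs_of_nonneg hpa,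
            abs_of_nonneg (mul_nonneg h2p hb0)]
      _ ≤ p * a * (‖h‖ * ‖k‖) + p * (2 - p) * b * ((‖x‖ * ‖h‖) * (‖x‖ * ‖k‖)) := by
          gcongr <;> exact abs_real_inner_le_norm _ _
      _ = p * a * (‖h‖ * ‖k‖) + p * (2 - p) * (b * ‖x‖ ^ 2) * (‖h‖ * ‖k‖) := by ring
      _ ≤ p * a * (‖h‖ * ‖k‖) + p * (2 - p) * a * (‖h‖ * ‖k‖) := by gcongr
      _ = p * (3 - p) * a * ‖h‖ * ‖k‖ := by ring
      _ ≤ p * (3 - p) * ‖x‖ ^ (p - 2) * ‖h‖ * ‖k‖ := by gcongr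
end

section
/- Let H be a real inner product space, let p ∈ (1,2) and ρ > 0, and define U_ρ : H → ℝ by U_ρ(x) = (‖x‖² + ρ)^{p/2}. Then the gradient of U_ρ is (p−1)-Hölder continuous: for all x₁, x₂ ∈ H, ‖∇U_ρ(x₁) − ∇U_ρ(x₂)‖ ≤ 2^p p ‖x₁ − x₂‖^{p−1}. -/
/-- The radial weight `t ↦ (t² + ρ)^{p/2-1}` is dominated by `t^{p-2}`. -/
lemma rpow_sq_add_le {p ρ t : ℝ} (hp : p ≤ 2) (hρ : 0 ≤ ρ) (ht : 0 < t) :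
    (t ^ 2 + ρ) ^ (p / 2 - 1) ≤ t ^ (p - 2) := by
  calc (t ^ 2 + ρ) ^ (p / 2 - 1) ≤ (t ^ 2) ^ (p / 2 - 1) :=
        Real.rpow_le_rpow_of_nonpos (by positivity) (by linarith) (by linarith)
    _ = t ^ (p - 2) := by
        rw [← Real.rpow_natCast_mul ht.le]
        congr 1
        push_cast
        ring

/-- The map `t ↦ (t² + ρ)^{p/2-1} t` is monotone on `[0, ∞)` for `p ≥ 1`. -/
lemma rpow_sq_add_mul_le {p ρ s t : ℝ} (hp : 1 ≤ p) (hρ : 0 < ρ) (hs : 0 ≤ s) (hst : s ≤ t) :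
    (s ^ 2 + ρ) ^ (p / 2 - 1) * s ≤ (t ^ 2 + ρ) ^ (p / 2 - 1) * t := by
  have ht : 0 ≤ t := hs.trans hst
  have hsq : s ^ 2 ≤ t ^ 2 := by gcongr
  have key : ∀ r : ℝ, 0 ≤ r → (r ^ 2 + ρ) ^ (p / 2 - 1) * r =
      (r ^ 2 + ρ) ^ ((p - 1) / 2) * √(r ^ 2 / (r ^ 2 + ρ)) := by
    intro r hr
    have hpos : 0 < r ^ 2 + ρ := by positivity
    rw [Real.sqrt_div (sq_nonneg r), Real.sqrt_sq hr, Real.sqrt_eq_rpow,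
      show p / 2 - 1 = (p - 1) / 2 - 1 / 2 by ring, Real.rpow_sub hpos]
    ring
  rw [key s hs, key t ht]
  have hexp : 0 ≤ (p - 1) / 2 := by linarith
  have hdiv : s ^ 2 / (s ^ 2 + ρ) ≤ t ^ 2 / (t ^ 2 + ρ) := by
    rw [div_le_div_iff₀ (by positivity) (by positivity)]
    nlinarith
  gcongr

/-- The Hölder bound, with the constant `2`, for `x ↦ (‖x‖² + ρ)^{p/2-1} x` when `‖y‖ ≤ ‖x‖`. -/
lemma norm_rpow_sq_add_smul_sub_le {H : Type*} [NormedAddCommGroup H] [NormedSpace ℝ H]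
    {p ρ : ℝ} (hp₁ : 1 < p) (hp₂ : p ≤ 2) (hρ : 0 < ρ) {x y : H} (hyx : ‖y‖ ≤ ‖x‖) :
    ‖(‖x‖ ^ 2 + ρ) ^ (p / 2 - 1) • x - (‖y‖ ^ 2 + ρ) ^ (p / 2 - 1) • y‖ ≤
      2 * ‖x - y‖ ^ (p - 1) := by
  rcases eq_or_ne x y with rfl | hxy
  · simp only [sub_self, norm_zero]
    positivity
  have hd : 0 < ‖x - y‖ := norm_pos_iff.2 (sub_ne_zero.2 hxy)
  have hx : 0 < ‖x‖ := by
    by_contra! h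
    have hx0 : x = 0 := norm_le_zero_iff.1 h
    have hy0 : y = 0 := norm_le_zero_iff.1 (hyx.trans h)
    exact hxy (hx0.trans hy0.symm)
  have hmono := rpow_sq_add_mul_le hp₁.le hρ (norm_nonneg y) hyx
  have hle := rpow_sq_add_le hp₂ hρ.le hx
  have hanti : (‖x‖ ^ 2 + ρ) ^ (p / 2 - 1) ≤ (‖y‖ ^ 2 + ρ) ^ (p / 2 - 1) :=
    Real.rpow_le_rpow_of_nonpos (by positivity) (by gcongr) (by linarith)
  have ha : 0 ≤ (‖x‖ ^ 2 + ρ) ^ (p / 2 - 1) := by positivity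
  have hb : 0 ≤ (‖y‖ ^ 2 + ρ) ^ (p / 2 - 1) := by positivity
  generalize (‖x‖ ^ 2 + ρ) ^ (p / 2 - 1) = a at *
  generalize (‖y‖ ^ 2 + ρ) ^ (p / 2 - 1) = b at *
  have hmul : ∀ r : ℝ, 0 < r → r ^ (p - 2) * r = r ^ (p - 1) := by
    intro r hr
    rw [← Real.rpow_add_one hr.ne']
    congr 1
    ring
  rcases le_total ‖x‖ ‖x - y‖ with h | h
  · have hax : a * ‖x‖ ≤ ‖x - y‖ ^ (p - 1) :=
      calc a * ‖x‖ ≤ ‖x‖ ^ (p - 2) * ‖x‖ := by gcongr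
        _ = ‖x‖ ^ (p - 1) := hmul _ hx
        _ ≤ ‖x - y‖ ^ (p - 1) := Real.rpow_le_rpow hx.le h (by linarith)
    calc ‖a • x - b • y‖ ≤ ‖a • x‖ + ‖b • y‖ := norm_sub_le _ _
      _ = a * ‖x‖ + b * ‖y‖ := by
        rw [norm_smul_of_nonneg ha, norm_smul_of_nonneg hb]
      _ ≤ 2 * ‖x - y‖ ^ (p - 1) := by linarith
  · have had : a * ‖x - y‖ ≤ ‖x - y‖ ^ (p - 1) :=
      calc a * ‖x - y‖ ≤ ‖x - y‖ ^ (p - 2) * ‖x - y‖ := by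
            gcongr
            exact hle.trans (Real.rpow_le_rpow_of_nonpos hd h (by linarith))
        _ = ‖x - y‖ ^ (p - 1) := hmul _ hd
    calc ‖a • x - b • y‖ = ‖a • (x - y) - (b - a) • y‖ := by
          congr 1
          module
      _ ≤ ‖a • (x - y)‖ + ‖(b - a) • y‖ := norm_sub_le _ _
      _ = a * ‖x - y‖ + (b - a) * ‖y‖ := by
        rw [norm_smul_of_nonneg ha, norm_smul_of_nonneg (sub_nonneg.2 hanti)]
      _ ≤ a * ‖x - y‖ + a * (‖x‖ - ‖y‖) := by linarith
      _ ≤ a * ‖x - y‖ + a * ‖x - y‖ := by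
        gcongr
        exact norm_sub_norm_le x y
      _ ≤ 2 * ‖x - y‖ ^ (p - 1) := by linarith

/-- For a real inner product space `H`, `p ∈ (1,2)`, `ρ > 0`, the gradient
`∇U_ρ(x) = p (‖x‖² + ρ)^{p/2-1} x` of `U_ρ(x) = (‖x‖² + ρ)^{p/2}` is `(p-1)`-Hölder
continuous: `‖∇U_ρ(x₁) - ∇U_ρ(x₂)‖ ≤ 2^p p ‖x₁ - x₂‖^{p-1}` for all `x₁, x₂`. -/
theorem stmt_2 {H : Type*} [NormedAddCommGroup H] [InnerProductSpace ℝ H]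
    (p ρ : ℝ) (hp : p ∈ Set.Ioo (1 : ℝ) 2) (hρ : 0 < ρ)
    (g : H → H) (hg : ∀ x, g x = (p * (‖x‖ ^ 2 + ρ) ^ (p / 2 - 1)) • x)
    (x₁ x₂ : H) :
    ‖g x₁ - g x₂‖ ≤ 2 ^ p * p * ‖x₁ - x₂‖ ^ (p - 1) := by
  obtain ⟨hp₁, hp₂⟩ := hp
  have hmain : ‖(‖x₁‖ ^ 2 + ρ) ^ (p / 2 - 1) • x₁ - (‖x₂‖ ^ 2 + ρ) ^ (p / 2 - 1) • x₂‖ ≤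
      2 * ‖x₁ - x₂‖ ^ (p - 1) := by
    rcases le_total ‖x₂‖ ‖x₁‖ with h | h
    · exact norm_rpow_sq_add_smul_sub_le hp₁ hp₂.le hρ h
    · rw [norm_sub_rev, norm_sub_rev x₁]
      exact norm_rpow_sq_add_smul_sub_le hp₁ hp₂.le hρ h
  have hp₀ : 0 ≤ p := by linarith
  have htwo : (2 : ℝ) ≤ 2 ^ p := Real.self_le_rpow_of_one_le one_le_two hp₁.le
  rw [hg, hg, mul_smul, mul_smul, ← smul_sub, norm_smul_of_nonneg hp₀]
  calc p * ‖(‖x₁‖ ^ 2 + ρ) ^ (p / 2 - 1) • x₁ - (‖x₂‖ ^ 2 + ρ) ^ (p / 2 - 1) • x₂‖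
      ≤ p * (2 * ‖x₁ - x₂‖ ^ (p - 1)) := by gcongr
    _ = 2 * p * ‖x₁ - x₂‖ ^ (p - 1) := by ring
    _ ≤ 2 ^ p * p * ‖x₁ - x₂‖ ^ (p - 1) := by gcongr
end

section
/- Let E be a real Banach space, τ > 0, M ≥ 0, and let h : ℝ → E be a strongly measurable function which is τ-periodic (h(s + τ) = h(s) for all s ∈ ℝ) and satisfies ‖h(s)‖ ≤ M for almost every s. Then for every a ∈ ℝ and every T > 0, ‖ (1/T) ∫_a^{a+T} h(s) ds − (1/τ) ∫_0^τ h(s) ds ‖ ≤ 2τM / T. -/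
open MeasureTheory

/-- A strongly measurable function on `ℝ` that is a.e. bounded is interval integrable. -/
lemma intervalIntegrable_of_ae_norm_le {E : Type*} [NormedAddCommGroup E] {M : ℝ} {h : ℝ → E}
    (hmeas : StronglyMeasurable h) (hbd : ∀ᵐ s ∂(volume : Measure ℝ), ‖h s‖ ≤ M) (a b : ℝ) :
    IntervalIntegrable h volume a b :=
  (intervalIntegrable_const (c := M)).mono_fun hmeas.aestronglyMeasurable <|
    (ae_restrict_of_ae hbd).mono fun _ hs ↦ hs.trans (le_abs_self M)

/-- If `h : ℝ → E` (E a real Banach space) is strongly measurable,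
`τ`-periodic and bounded a.e. by `M`, then for every `a ∈ ℝ` and `T > 0`,
`‖(1/T) ∫_a^{a+T} h - (1/τ) ∫_0^τ h‖ ≤ 2τM/T`. -/
theorem stmt_3 {E : Type*} [NormedAddCommGroup E] [NormedSpace ℝ E] [CompleteSpace E]
    (τ M : ℝ) (hτ : 0 < τ) (hM : 0 ≤ M)
    (h : ℝ → E) (hmeas : StronglyMeasurable h)
    (hper : ∀ s : ℝ, h (s + τ) = h s)
    (hbd : ∀ᵐ s ∂(volume : Measure ℝ), ‖h s‖ ≤ M)
    (a T : ℝ) (hT : 0 < T) :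
    ‖(1 / T) • (∫ s in a..(a + T), h s) - (1 / τ) • (∫ s in (0 : ℝ)..τ, h s)‖
      ≤ 2 * τ * M / T := by
  have hint := intervalIntegrable_of_ae_norm_le hmeas hbd
  have hnorm (b c : ℝ) : ‖∫ s in b..c, h s‖ ≤ M * |c - b| :=
    intervalIntegral.norm_integral_le_of_norm_le_const_ae (hbd.mono fun _ hs _ ↦ hs)
  have hp : Function.Periodic h τ := hper
  set n : ℤ := ⌊T / τ⌋
  have hn_le : n * τ ≤ T := (le_div_iff₀ hτ).1 (Int.floor_le _)
  have hn_lt : T < (n + 1) * τ := (div_lt_iff₀ hτ).1 (Int.lt_floor_add_one _)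
  have hwhole : ∫ s in a..(a + n * τ), h s = (n : ℝ) • ∫ s in (0 : ℝ)..τ, h s := by
    have := hp.intervalIntegral_add_zsmul_eq n a hint
    rwa [hp.intervalIntegral_add_eq a 0, zero_add, zsmul_eq_mul,
      ← Int.cast_smul_eq_zsmul ℝ] at this
  have hperiod : ‖∫ s in (0 : ℝ)..τ, h s‖ ≤ M * τ := by
    simpa [abs_of_pos hτ] using hnorm 0 τ
  have hrest : ‖∫ s in (a + n * τ)..(a + T), h s‖ ≤ M * τ := by
    refine (hnorm _ _).trans (mul_le_mul_of_nonneg_left ?_ hM)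
    rw [abs_le]
    constructor <;> linarith
  have hcoef : |(n * τ - T) / τ| ≤ 1 := by
    rw [abs_div, abs_of_pos hτ, div_le_one hτ, abs_le]
    constructor <;> linarith
  have hdecomp : (1 / T) • (∫ s in a..(a + T), h s) - (1 / τ) • (∫ s in (0 : ℝ)..τ, h s) =
      (1 / T) • (((n * τ - T) / τ) • (∫ s in (0 : ℝ)..τ, h s) +
        ∫ s in (a + n * τ)..(a + T), h s) := by
    rw [← intervalIntegral.integral_add_adjacent_intervals (hint a (a + n * τ)) (hint _ _), hwhole]
    match_scalars <;> field_simp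
  rw [hdecomp, norm_smul, Real.norm_of_nonneg (by positivity), one_div_mul_eq_div]
  gcongr
  calc _ ≤ |(n * τ - T) / τ| * ‖∫ s in (0 : ℝ)..τ, h s‖ +
        ‖∫ s in (a + n * τ)..(a + T), h s‖ := by
        rw [← Real.norm_eq_abs, ← norm_smul]
        exact norm_add_le _ _
    _ ≤ 1 * (M * τ) + M * τ := by gcongr
    _ = 2 * τ * M := by ring
end

section
/- Let β₁ > 0 and let φ₂ : [0,∞) → [0,∞) be measurable, locally integrable, and satisfy φ₂(s) → 0 as s → ∞. Define, for T > 0, φ̃₂(T) := sup_{t ≥ 0} (1/T) ∫_t^{t+T} ( ∫_0^s e^{−β₁(s−u)} φ₂(u) du ) ds. Then lim_{T → ∞} φ̃₂(T) = 0. -/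
open MeasureTheory Filter

/-- Monotonicity of the interval integral for a nonnegative integrand, with no integrability
assumption on the smaller function. -/
lemma intervalIntegral_mono_of_nonneg {a b : ℝ} (hab : a ≤ b) {f g : ℝ → ℝ}
    (hf : ∀ x, a < x → x ≤ b → 0 ≤ f x) (hg : IntervalIntegrable g volume a b)
    (hfg : ∀ x, a < x → x ≤ b → f x ≤ g x) :
    ∫ x in a..b, f x ≤ ∫ x in a..b, g x := by
  rw [intervalIntegral.integral_of_le hab, intervalIntegral.integral_of_le hab]
  exact integral_mono_of_nonneg
    (ae_restrict_of_forall_mem measurableSet_Ioc fun x hx => hf x hx.1 hx.2)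
    ((intervalIntegrable_iff_integrableOn_Ioc_of_le hab).1 hg)
    (ae_restrict_of_forall_mem measurableSet_Ioc fun x hx => hfg x hx.1 hx.2)

lemma integral_exp_neg_mul {β : ℝ} (hβ : 0 < β) (a b : ℝ) :
    ∫ s in a..b, Real.exp (-β * s) = (Real.exp (-β * a) - Real.exp (-β * b)) / β := by
  rw [intervalIntegral.integral_comp_mul_left (fun x => Real.exp x) (neg_ne_zero.2 hβ.ne'),
    integral_exp, smul_eq_mul]
  field_simp
  ring

lemma integral_exp_neg_mul_sub_le {β : ℝ} (hβ : 0 < β) (s : ℝ) :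
    ∫ u in (0 : ℝ)..s, Real.exp (-β * (s - u)) ≤ 1 / β := by
  rw [intervalIntegral.integral_comp_sub_left (fun x => Real.exp (-β * x)) s,
    integral_exp_neg_mul hβ]
  gcongr
  have := Real.exp_pos (-β * (s - 0))
  simp only [sub_self, mul_zero, Real.exp_zero]
  linarith

/-- If `φ ≤ δ` beyond `A`, then the exponential convolution of `φ` is at most a decaying
exponential plus `δ / β`. -/
lemma exp_convolution_le {β δ A : ℝ} (hβ : 0 < β) (hδ : 0 ≤ δ) {φ : ℝ → ℝ}
    (hnonneg : ∀ s, 0 ≤ s → 0 ≤ φ s) (hloc : IntegrableOn φ (Set.Icc 0 A))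
    (hA : ∀ s, A ≤ s → φ s ≤ δ) {s : ℝ} (hs : 0 ≤ s) :
    ∫ u in (0 : ℝ)..s, Real.exp (-β * (s - u)) * φ u ≤
      Real.exp (β * A) * (∫ u in Set.Icc 0 A, φ u) * Real.exp (-β * s) + δ / β := by
  set ψ : ℝ → ℝ := (Set.Icc 0 A).indicator φ
  have hψ0 : ∀ u, 0 ≤ ψ u := Set.indicator_nonneg fun u hu => hnonneg u hu.1
  have hψi : Integrable ψ := hloc.integrable_indicator measurableSet_Icc
  have hexp : IntervalIntegrable (fun u => Real.exp (-β * (s - u))) volume 0 s :=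
    Continuous.intervalIntegrable (by fun_prop) _ _
  have hle : ∫ u in (0 : ℝ)..s, ψ u ≤ ∫ u in Set.Icc 0 A, φ u := by
    rw [intervalIntegral.integral_of_le hs, ← integral_indicator measurableSet_Icc]
    exact setIntegral_le_integral hψi (Eventually.of_forall hψ0)
  calc ∫ u in (0 : ℝ)..s, Real.exp (-β * (s - u)) * φ u
      ≤ ∫ u in (0 : ℝ)..s,
          (Real.exp (β * A) * Real.exp (-β * s) * ψ u + δ * Real.exp (-β * (s - u))) := by
        refine intervalIntegral_mono_of_nonneg hs
          (fun u hu _ => mul_nonneg (Real.exp_pos _).le (hnonneg u hu.le))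
          ((hψi.intervalIntegrable.const_mul _).add (hexp.const_mul _)) fun u hu _ => ?_
        rcases le_or_gt u A with h | h
        · have h1 : ψ u = φ u := Set.indicator_of_mem (Set.mem_Icc.2 ⟨hu.le, h⟩) φ
          have h2 : Real.exp (-β * (s - u)) ≤ Real.exp (β * A) * Real.exp (-β * s) := by
            rw [← Real.exp_add]
            gcongr
            nlinarith
          rw [h1]
          have := mul_le_mul_of_nonneg_right h2 (hnonneg u hu.le)
          have := mul_nonneg hδ (Real.exp_pos (-β * (s - u))).le
          linarith
        · have h1 := mul_le_mul_of_nonneg_left (hA u h.le) (Real.exp_pos (-β * (s - u))).le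
          have h2 := mul_nonneg
            (mul_pos (Real.exp_pos (β * A)) (Real.exp_pos (-β * s))).le (hψ0 u)
          linarith
    _ = Real.exp (β * A) * Real.exp (-β * s) * (∫ u in (0 : ℝ)..s, ψ u) +
          δ * ∫ u in (0 : ℝ)..s, Real.exp (-β * (s - u)) := by
        rw [intervalIntegral.integral_add (hψi.intervalIntegrable.const_mul _)
          (hexp.const_mul _), intervalIntegral.integral_const_mul,
          intervalIntegral.integral_const_mul]
    _ ≤ Real.exp (β * A) * Real.exp (-β * s) * (∫ u in Set.Icc 0 A, φ u) + δ * (1 / β) := by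
        gcongr
        exact integral_exp_neg_mul_sub_le hβ s
    _ = _ := by ring

/-- If `β₁ > 0` and `φ₂ : [0,∞) → [0,∞)` is measurable, locally integrable
and tends to `0` at infinity, then
`φ̃₂(T) := sup_{t ≥ 0} (1/T) ∫_t^{t+T} (∫_0^s e^{-β₁(s-u)} φ₂(u) du) ds → 0` as `T → ∞`,
i.e. the window averages of the exponential convolution tend to `0` uniformly in `t ≥ 0`. -/
theorem stmt_6 (β₁ : ℝ) (hβ₁ : 0 < β₁) (φ₂ : ℝ → ℝ) (hmeas : Measurable φ₂)
    (hnonneg : ∀ s, 0 ≤ s → 0 ≤ φ₂ s)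
    (hloc : ∀ b : ℝ, IntegrableOn φ₂ (Set.Icc 0 b))
    (hlim : Tendsto φ₂ atTop (nhds 0)) :
    ∀ ε > (0 : ℝ), ∃ T₀ > (0 : ℝ), ∀ T ≥ T₀, ∀ t ≥ (0 : ℝ),
      (1 / T) * ∫ s in t..(t + T), (∫ u in (0 : ℝ)..s, Real.exp (-β₁ * (s - u)) * φ₂ u)
        < ε := by
  intro ε hε
  have hδ : 0 < β₁ * ε / 2 := by positivity
  obtain ⟨A, hA⟩ := eventually_atTop.1 (hlim.eventually_le_const hδ)
  set K : ℝ := Real.exp (β₁ * A) * ∫ u in Set.Icc 0 A, φ₂ u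
  have hK0 : 0 ≤ K := mul_nonneg (Real.exp_pos _).le
    (setIntegral_nonneg measurableSet_Icc fun u hu => hnonneg u hu.1)
  refine ⟨2 * K / (β₁ * ε) + 1, by positivity, fun T hT t ht => ?_⟩
  have hT0 : 0 < T := lt_of_lt_of_le (by positivity) hT
  have hexp : IntervalIntegrable (fun s => K * Real.exp (-β₁ * s)) volume t (t + T) :=
    Continuous.intervalIntegrable (by fun_prop) _ _
  have hbound : ∫ s in t..(t + T), (∫ u in (0 : ℝ)..s, Real.exp (-β₁ * (s - u)) * φ₂ u) ≤
      K / β₁ + T * (ε / 2) := by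
    calc ∫ s in t..(t + T), (∫ u in (0 : ℝ)..s, Real.exp (-β₁ * (s - u)) * φ₂ u)
        ≤ ∫ s in t..(t + T), (K * Real.exp (-β₁ * s) + ε / 2) := by
          refine intervalIntegral_mono_of_nonneg (by linarith) (fun s hs _ => ?_)
            (hexp.add intervalIntegrable_const) fun s hs _ => ?_
          · exact intervalIntegral.integral_nonneg (ht.le.trans hs.le) fun u hu =>
              mul_nonneg (Real.exp_pos _).le (hnonneg u hu.1)
          · have h := exp_convolution_le hβ₁ hδ.le hnonneg (hloc A) hA (ht.le.trans hs.le)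
            rwa [show β₁ * ε / 2 / β₁ = ε / 2 by field_simp] at h
      _ = K * ((Real.exp (-β₁ * t) - Real.exp (-β₁ * (t + T))) / β₁) + T * (ε / 2) := by
          rw [intervalIntegral.integral_add hexp intervalIntegrable_const,
            intervalIntegral.integral_const_mul, integral_exp_neg_mul hβ₁,
            intervalIntegral.integral_const, smul_eq_mul, add_sub_cancel_left]
      _ ≤ K * (1 / β₁) + T * (ε / 2) := by
          have h1 : Real.exp (-β₁ * t) ≤ 1 := Real.exp_le_one_iff.2 (by nlinarith)
          have h2 := Real.exp_pos (-β₁ * (t + T))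
          gcongr
          linarith
      _ = _ := by ring
  have hKT : K / β₁ < T * (ε / 2) := by
    have h : 2 * K / (β₁ * ε) < T := by linarith
    rw [div_lt_iff₀ (by positivity)] at h
    rw [div_lt_iff₀ hβ₁]
    linarith
  rw [one_div, inv_mul_lt_iff₀ hT0]
  linarith
end

section
/- Let β > 0 and 0 ≤ L < β, let t ∈ ℝ and T > 0, and let g, v : [t, t+T] → [0,∞) be measurable and integrable. Suppose that for every r ∈ [t, t+T], v(r) ≤ ∫_t^r e^{−β(r−s)} ( g(s) + L v(s) ) ds. Then ∫_t^{t+T} v(r) dr ≤ (β/(β−L)) ∫_t^{t+T} ( ∫_t^r e^{−β(r−s)} g(s) ds ) dr. -/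
open MeasureTheory

theorem expKernel_eq (β t r : ℝ) (h : ℝ → ℝ) :
    (∫ s in t..r, Real.exp (-β * (r - s)) * h s)
      = (∫ s in t..r, Real.exp (β * s) * h s) * Real.exp (-β * r) := by
  rw [← intervalIntegral.integral_mul_const]
  congr 1 with s
  rw [mul_right_comm, ← Real.exp_add]
  ring_nf

theorem IntervalIntegrable.exp_mul {a b : ℝ} {h : ℝ → ℝ} (hh : IntervalIntegrable h volume a b)
    (β : ℝ) : IntervalIntegrable (fun s ↦ Real.exp (β * s) * h s) volume a b :=
  hh.continuousOn_mul (by fun_prop)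

theorem intervalIntegrable_expKernel {a b : ℝ} {h : ℝ → ℝ} (hh : IntervalIntegrable h volume a b)
    (β : ℝ) :
    IntervalIntegrable (fun r ↦ ∫ s in a..r, Real.exp (-β * (r - s)) * h s) volume a b := by
  simp_rw [expKernel_eq]
  exact ((intervalIntegral.continuousOn_primitive_interval'
    (hh.exp_mul β) Set.left_mem_uIcc).mul (by fun_prop)).intervalIntegrable

/-- Integrating `y' = h - β y` for `y r = ∫_a^r e^{-β(r-s)} h(s) ds`. -/
theorem mul_integral_expKernel {a b : ℝ} {h : ℝ → ℝ} (hh : IntervalIntegrable h volume a b)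
    (β : ℝ) :
    β * (∫ r in a..b, ∫ s in a..r, Real.exp (-β * (r - s)) * h s)
      = (∫ r in a..b, h r) - ∫ s in a..b, Real.exp (-β * (b - s)) * h s := by
  set F : ℝ → ℝ := fun r ↦ ∫ s in a..r, Real.exp (β * s) * h s with hF
  have hFac : AbsolutelyContinuousOnInterval F a b :=
    (hh.exp_mul β).absolutelyContinuousOnInterval_intervalIntegral Set.left_mem_uIcc
  have hw (x : ℝ) : HasDerivAt (fun r ↦ Real.exp (-β * r)) (-β * Real.exp (-β * x)) x := by
    simpa [mul_comm] using ((hasDerivAt_id x).const_mul (-β)).exp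
  have hwac : AbsolutelyContinuousOnInterval (fun r ↦ Real.exp (-β * r)) a b := by
    have hc : ContDiff ℝ 1 (fun r ↦ Real.exp (-β * r)) := by fun_prop
    exact hc.contDiffOn.absolutelyContinuousOnInterval
  have key := hFac.integral_mul_deriv_eq_deriv_mul hwac
  have hder : (∫ x in a..b, deriv F x * Real.exp (-β * x)) = ∫ x in a..b, h x := by
    refine intervalIntegral.integral_congr_ae ?_
    filter_upwards [(hh.exp_mul β).ae_hasDerivAt_integral] with x hx hxm
    rw [(hx (Set.uIoc_subset_uIcc hxm) a Set.left_mem_uIcc).deriv, mul_right_comm, ← Real.exp_add]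
    simp
  simp_rw [expKernel_eq, ← intervalIntegral.integral_const_mul]
  rw [hder] at key
  have hFa : F a = 0 := by simp [hF]
  have hneg : (∫ x in a..b, F x * deriv (fun r ↦ Real.exp (-β * r)) x)
      = -∫ x in a..b, β * (F x * Real.exp (-β * x)) := by
    rw [← intervalIntegral.integral_neg]
    congr 1 with x
    rw [(hw x).deriv]
    ring
  rw [hneg, hFa] at key
  linarith

/-- Grönwall-type inequality in integrated form for the exponential kernel:
if `0 ≤ L < β` and `v(r) ≤ ∫_t^r e^{-β(r-s)} (g(s) + L v(s)) ds` for all `r ∈ [t, t+T]`,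
with `g, v` nonnegative, measurable and integrable on `[t, t+T]`, then
`∫_t^{t+T} v ≤ (β/(β-L)) ∫_t^{t+T} (∫_t^r e^{-β(r-s)} g(s) ds) dr`. -/
theorem stmt_8 (β L : ℝ) (hL : 0 ≤ L) (hLβ : L < β) (t T : ℝ) (hT : 0 < T)
    (g v : ℝ → ℝ) (hgmeas : Measurable g) (hvmeas : Measurable v)
    (hgn : ∀ r ∈ Set.Icc t (t + T), 0 ≤ g r)
    (hvn : ∀ r ∈ Set.Icc t (t + T), 0 ≤ v r)
    (hgi : IntegrableOn g (Set.Icc t (t + T)))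
    (hvi : IntegrableOn v (Set.Icc t (t + T)))
    (hyp : ∀ r ∈ Set.Icc t (t + T),
      v r ≤ ∫ s in t..r, Real.exp (-β * (r - s)) * (g s + L * v s)) :
    (∫ r in t..(t + T), v r)
      ≤ (β / (β - L)) * ∫ r in t..(t + T), (∫ s in t..r, Real.exp (-β * (r - s)) * g s) := by
  have hle : t ≤ t + T := by linarith
  have hgI : IntervalIntegrable g volume t (t + T) :=
    (intervalIntegrable_iff_integrableOn_Icc_of_le hle).2 hgi
  have hvI : IntervalIntegrable v volume t (t + T) :=
    (intervalIntegrable_iff_integrableOn_Icc_of_le hle).2 hvi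
  have hbound : (∫ r in t..(t + T), v r)
      ≤ (∫ r in t..(t + T), ∫ s in t..r, Real.exp (-β * (r - s)) * g s)
        + L * ∫ r in t..(t + T), ∫ s in t..r, Real.exp (-β * (r - s)) * v s := by
    rw [← intervalIntegral.integral_const_mul, ← intervalIntegral.integral_add
      (intervalIntegrable_expKernel hgI β) ((intervalIntegrable_expKernel hvI β).const_mul L)]
    refine intervalIntegral.integral_mono_on hle hvI ((intervalIntegrable_expKernel hgI β).add
      ((intervalIntegrable_expKernel hvI β).const_mul L)) fun r hr ↦ (hyp r hr).trans_eq ?_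
    have hsub : Set.uIcc t r ⊆ Set.uIcc t (t + T) := by
      rw [Set.uIcc_of_le hr.1, Set.uIcc_of_le hle]
      exact Set.Icc_subset_Icc_right hr.2
    rw [← intervalIntegral.integral_const_mul, ← intervalIntegral.integral_add
      ((hgI.mono_set hsub).continuousOn_mul (by fun_prop))
      (((hvI.mono_set hsub).continuousOn_mul (by fun_prop)).const_mul L)]
    congr 1 with s
    ring
  have hv := mul_integral_expKernel hvI β
  have hvT : 0 ≤ ∫ s in t..(t + T), Real.exp (-β * (t + T - s)) * v s :=
    intervalIntegral.integral_nonneg hle fun s hs ↦ mul_nonneg (Real.exp_pos _).le (hvn s hs)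
  have hpos : 0 < β - L := sub_pos.2 hLβ
  rw [div_mul_eq_mul_div, le_div_iff₀ hpos]
  have hβ : 0 ≤ β := hL.trans hLβ.le
  linarith [mul_le_mul_of_nonneg_left hbound hβ, mul_nonneg hL hvT, congrArg (L * ·) hv]
end

section
/- Let H be a real inner product space, let β > L ≥ 0 and c ≥ 0, let s ∈ ℝ, and let N : ℝ → H be differentiable on [s,∞) with ⟨N(t), N'(t)⟩ ≤ −β ‖N(t)‖² + ( c + L ‖N(t)‖ ) ‖N(t)‖ for every t ≥ s. Then for every t ≥ s, ‖N(t)‖ ≤ e^{−(β−L)(t−s)/2} ‖N(s)‖ + c/(β−L). -/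
open RealInnerProductSpace

/-- A differentiable real function on `[a, b]` with `f' ≤ K f + ε` satisfies the Grönwall bound. -/
theorem le_gronwallBound_of_hasDerivAt {f f' : ℝ → ℝ} {K ε a b : ℝ} (hab : a ≤ b)
    (hf : ∀ x ∈ Set.Icc a b, HasDerivAt f (f' x) x)
    (bound : ∀ x ∈ Set.Icc a b, f' x ≤ K * f x + ε) :
    f b ≤ gronwallBound (f a) K ε (b - a) :=
  le_gronwallBound_of_liminf_deriv_right_le
    (fun x hx => (hf x hx).continuousAt.continuousWithinAt)
    (fun x hx _ hr =>
      (hf x (Set.Ico_subset_Icc_self hx)).hasDerivWithinAt.liminf_right_slope_le hr)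
    le_rfl (fun x hx => bound x (Set.Ico_subset_Icc_self hx)) b (Set.right_mem_Icc.2 hab)

/-- Let `H` be a real inner product space, `β > L ≥ 0`, `c ≥ 0`, and let
`N : ℝ → H` be differentiable on `[s,∞)` with
`⟪N t, N' t⟫ ≤ -β ‖N t‖² + (c + L ‖N t‖) ‖N t‖` for every `t ≥ s`. Then for every `t ≥ s`,
`‖N t‖ ≤ e^{-(β-L)(t-s)/2} ‖N s‖ + c/(β-L)`. -/
theorem stmt_9 {H : Type*} [NormedAddCommGroup H] [InnerProductSpace ℝ H]
    (β L c : ℝ) (hL : 0 ≤ L) (hβ : L < β) (hc : 0 ≤ c) (s : ℝ)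
    (N N' : ℝ → H) (hderiv : ∀ t, s ≤ t → HasDerivAt N (N' t) t)
    (hineq : ∀ t, s ≤ t →
      ⟪N t, N' t⟫ ≤ -β * ‖N t‖ ^ 2 + (c + L * ‖N t‖) * ‖N t‖)
    (t : ℝ) (ht : s ≤ t) :
    ‖N t‖ ≤ Real.exp (-(β - L) * (t - s) / 2) * ‖N s‖ + c / (β - L) := by
  have hk : 0 < β - L := sub_pos.2 hβ
  have hu := le_gronwallBound_of_hasDerivAt (f := fun x => ‖N x‖ ^ 2)
    (K := -(β - L)) (ε := c ^ 2 / (β - L)) ht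
    (fun x hx => (hderiv x hx.1).norm_sq) (fun x hx => by
      have h := hineq x hx.1
      have young : 2 * c * ‖N x‖ ≤ (β - L) * ‖N x‖ ^ 2 + c ^ 2 / (β - L) := by
        have hsq : 0 ≤ ((β - L) * ‖N x‖ - c) ^ 2 / (β - L) := by positivity
        have heq : ((β - L) * ‖N x‖ - c) ^ 2 / (β - L)
            = (β - L) * ‖N x‖ ^ 2 + c ^ 2 / (β - L) - 2 * c * ‖N x‖ := by
          field_simp
          ring
        linarith
      linarith)
  rw [gronwallBound_of_K_ne_0 (neg_ne_zero.2 hk.ne')] at hu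
  set e := Real.exp (-(β - L) * (t - s) / 2)
  have he : Real.exp (-(β - L) * (t - s)) = e ^ 2 := by
    rw [← Real.exp_nat_mul]
    congr 1
    push_cast
    ring
  have hε : c ^ 2 / (β - L) / -(β - L) = -(c / (β - L)) ^ 2 := by
    field_simp
  beta_reduce at hu
  rw [he, hε] at hu
  refine abs_le_of_sq_le_sq' ?_ (by positivity) |>.2
  have hcross : 0 ≤ e * ‖N s‖ * (c / (β - L)) := by positivity
  have hsq : 0 ≤ (e * (c / (β - L))) ^ 2 := sq_nonneg _
  linarith
end

section
/- Let H be a separable real Hilbert space with its Borel σ-algebra, and let (P_{s,t})_{s ≤ t} be a two-parameter family of Markov kernels from H to H. Suppose there exist a family (μ_t)_{t ∈ ℝ} of Borel probability measures on H and constants C ≥ 0, a > 0 such that for every bounded Lipschitz function φ : H → ℝ, all s ≤ t and all y ∈ H, | ∫_H φ(z) P_{s,t}(y, dz) − ∫_H φ(z) μ_t(dz) | ≤ C · Lip(φ) · (1 + ‖y‖) · e^{−a(t−s)}, where Lip(φ) is the Lipschitz constant of φ. If (ν_t)_{t ∈ ℝ} is an evolution system of measures for (P_{s,t}) satisfying sup_{t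 ∈ ℝ} ∫_H ‖y‖ ν_t(dy) < ∞, then ν_t = μ_t for every t ∈ ℝ. -/
open MeasureTheory ProbabilityTheory

/-- A family `(ν_t)_{t ∈ ℝ}` of measures is an *evolution system of measures* for the
two-parameter family of kernels `(P_{s,t})_{s ≤ t}` if for all `s ≤ t` and every bounded
continuous `φ : H → ℝ`, `∫ (∫ φ(z) P_{s,t}(y,dz)) ν_s(dy) = ∫ φ(z) ν_t(dz)`. -/
def IsEvolutionSystemOfMeasures {H : Type*} [MeasurableSpace H] [TopologicalSpace H]
    (P : ℝ → ℝ → Kernel H H) (ν : ℝ → Measure H) : Prop :=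
  ∀ s t : ℝ, s ≤ t → ∀ φ : BoundedContinuousFunction H ℝ,
    (∫ y, (∫ z, φ z ∂(P s t y)) ∂(ν s)) = ∫ z, φ z ∂(ν t)

open Filter Topology

/-- Two finite measures on a metric space are equal if they integrate every bounded Lipschitz
function to the same value. -/
theorem MeasureTheory.ext_of_forall_integral_eq_of_lipschitzWith {X : Type*} [PseudoMetricSpace X]
    [MeasurableSpace X] [BorelSpace X] {μ ν : Measure X} [IsFiniteMeasure μ] [IsFiniteMeasure ν]
    (h : ∀ (K : NNReal) (φ : X → ℝ), LipschitzWith K φ → (∃ M : ℝ, ∀ x, |φ x| ≤ M) →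
      ∫ x, φ x ∂μ = ∫ x, φ x ∂ν) :
    μ = ν := by
  have hclosed : ∀ F : Set X, IsClosed F → μ F = ν F := by
    intro F hF
    obtain ⟨δ, -, hδ, hδ0⟩ := exists_seq_strictAnti_tendsto (0 : ℝ)
    have hμ := tendsto_integral_thickenedIndicator_of_isClosed μ hF hδ hδ0
    have hν := tendsto_integral_thickenedIndicator_of_isClosed ν hF hδ hδ0
    refine (measureReal_eq_measureReal_iff).1 (tendsto_nhds_unique hμ (hν.congr fun n ↦ ?_))
    refine (h _ _ (NNReal.isometry_coe.lipschitz.comp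
      (lipschitzWith_thickenedIndicator (hδ n) F)) ⟨1, fun x ↦ ?_⟩).symm
    simpa using thickenedIndicator_le_one (hδ n) F x
  exact ext_of_generate_finite _ (BorelSpace.measurable_eq.trans borel_eq_generateFrom_isClosed)
    isPiSystem_isClosed hclosed (hclosed _ isClosed_univ)

/-- If `κ` moves the integral of `φ` to within `c * (1 + ‖y‖)` of a constant `m`, then averaging
over a probability measure with first moment at most `M` stays within `c * (1 + M)` of `m`. -/
theorem ProbabilityTheory.abs_integral_integral_sub_le {H : Type*} [NormedAddCommGroup H]
    [MeasurableSpace H] [BorelSpace H] [SecondCountableTopology H] (κ : Kernel H H)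
    [IsMarkovKernel κ] {ν : Measure H} [IsProbabilityMeasure ν] {φ : H → ℝ} (hφ : Continuous φ)
    (hbdd : ∃ B : ℝ, ∀ z, |φ z| ≤ B) {c m : ℝ} {M : ENNReal} (hc : 0 ≤ c) (hM : M ≠ ⊤)
    (hmom : ∫⁻ y, ‖y‖₊ ∂ν ≤ M)
    (h : ∀ y, |(∫ z, φ z ∂(κ y)) - m| ≤ c * (1 + ‖y‖)) :
    |(∫ y, (∫ z, φ z ∂(κ y)) ∂ν) - m| ≤ c * (1 + M.toReal) := by
  obtain ⟨B, hB⟩ := hbdd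
  have hnorm : Integrable (fun y : H ↦ ‖y‖) ν :=
    Integrable.norm (f := fun y : H ↦ y) ⟨by fun_prop, hmom.trans_lt hM.lt_top⟩
  have hint : Integrable (fun y ↦ ∫ z, φ z ∂(κ y)) ν := by
    refine .of_bound hφ.stronglyMeasurable.integral_kernel.aestronglyMeasurable B
      (ae_of_all _ fun y ↦ ?_)
    simpa using norm_integral_le_of_norm_le_const (μ := κ y) (f := φ) (ae_of_all _ hB)
  have hnorm_le : ∫ y, ‖y‖ ∂ν ≤ M.toReal := by
    rw [integral_norm_eq_lintegral_enorm (by fun_prop)]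
    exact ENNReal.toReal_mono hM hmom
  calc |(∫ y, (∫ z, φ z ∂(κ y)) ∂ν) - m|
      = ‖∫ y, ((∫ z, φ z ∂(κ y)) - m) ∂ν‖ := by
        rw [integral_sub hint (integrable_const m)]
        simp
    _ ≤ ∫ y, c * (1 + ‖y‖) ∂ν :=
        norm_integral_le_of_norm_le (((integrable_const 1).add hnorm).const_mul c) (ae_of_all _ h)
    _ = c * (1 + ∫ y, ‖y‖ ∂ν) := by
        rw [integral_const_mul, integral_add (integrable_const 1) hnorm]
        simp
    _ ≤ c * (1 + M.toReal) := by gcongr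

/-- Uniqueness of the evolution system of measures: if the Markov kernels
`P_{s,t}` converge (as `s → -∞`) to `(μ_t)` in the sense that
`|P_{s,t}φ(y) - μ_t(φ)| ≤ C Lip(φ) (1+‖y‖) e^{-a(t-s)}` for all bounded Lipschitz `φ`,
then any evolution system `(ν_t)` of probability measures with uniformly bounded first
moments coincides with `(μ_t)`. -/
theorem stmt_13 {H : Type*} [NormedAddCommGroup H] [InnerProductSpace ℝ H]
    [CompleteSpace H] [SecondCountableTopology H] [MeasurableSpace H] [BorelSpace H]
    (P : ℝ → ℝ → Kernel H H) (hP : ∀ s t : ℝ, IsMarkovKernel (P s t))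
    (μ : ℝ → Measure H) (hμprob : ∀ t : ℝ, IsProbabilityMeasure (μ t))
    (C a : ℝ) (hC : 0 ≤ C) (ha : 0 < a)
    (hconv : ∀ (K : NNReal) (φ : H → ℝ), LipschitzWith K φ → (∃ M : ℝ, ∀ z, |φ z| ≤ M) →
      ∀ s t : ℝ, s ≤ t → ∀ y : H,
        |(∫ z, φ z ∂(P s t y)) - ∫ z, φ z ∂(μ t)|
          ≤ C * (K : ℝ) * (1 + ‖y‖) * Real.exp (-a * (t - s)))
    (ν : ℝ → Measure H) (hνprob : ∀ t : ℝ, IsProbabilityMeasure (ν t))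
    (hν : IsEvolutionSystemOfMeasures P ν)
    (hmom : (⨆ t : ℝ, ∫⁻ y, ‖y‖₊ ∂(ν t)) < ⊤) :
    ∀ t : ℝ, ν t = μ t := by
  intro t
  refine ext_of_forall_integral_eq_of_lipschitzWith fun K φ hφ hbdd ↦ ?_
  set M := ⨆ t : ℝ, ∫⁻ y, ‖y‖₊ ∂(ν t)
  have hbound : ∀ s ≤ t, |(∫ z, φ z ∂(ν t)) - ∫ z, φ z ∂(μ t)|
      ≤ C * K * Real.exp (-a * (t - s)) * (1 + M.toReal) := by
    intro s hst
    obtain ⟨B, hB⟩ := hbdd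
    have hevol := hν s t hst (BoundedContinuousFunction.ofNormedAddCommGroup φ hφ.continuous B hB)
    simp only [BoundedContinuousFunction.coe_ofNormedAddCommGroup] at hevol
    rw [← hevol]
    refine abs_integral_integral_sub_le (P s t) hφ.continuous ⟨B, hB⟩ (by positivity) hmom.ne
      (le_iSup (fun t : ℝ ↦ ∫⁻ y, ‖y‖₊ ∂(ν t)) s) fun y ↦ ?_
    exact (hconv K φ hφ ⟨B, hB⟩ s t hst y).trans_eq (by ring)
  have hlim : Tendsto (fun s ↦ C * K * Real.exp (-a * (t - s)) * (1 + M.toReal)) atBot (𝓝 0) := by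
    have hexponent : Tendsto (fun s : ℝ ↦ -a * (t - s)) atBot atBot :=
      (tendsto_atTop_add_const_left _ t tendsto_neg_atBot_atTop).const_mul_atTop_of_neg
        (neg_lt_zero.2 ha)
    simpa using ((Real.tendsto_exp_atBot.comp hexponent).const_mul (C * K)).mul_const
      (1 + M.toReal)
  have hle := ge_of_tendsto hlim ((eventually_le_atBot t).mono hbound)
  exact sub_eq_zero.1 (abs_nonpos_iff.1 hle)
end

section
/- Let H be a separable real Hilbert space with its Borel σ-algebra, let τ > 0, and let (P_{s,t})_{s ≤ t} be a two-parameter family of Markov kernels from H to H which is τ-periodic: P_{s+τ, t+τ} = P_{s,t} for all s ≤ t. Suppose (μ_t)_{t ∈ ℝ} is an evolution system of measures for (P_{s,t}) with sup_{t ∈ ℝ} ∫_H ‖y‖ μ_t(dy) < ∞, and that there exist constants C ≥ 0, a > 0 such that for every bounded Lipschitz function φ : H → ℝ, all s ≤ t and all y ∈ H, | ∫_H φ(z) P_{s,t}(y, dz) − ∫_H φ(z) μ_t(dz) | ≤ C · Lip(φ) · (1 + ‖y‖) · e^{−a(t−s)}. Then the evolution system is τ-periodic: μ_{t+τ} = μ_t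 for every t ∈ ℝ. -/
open MeasureTheory ProbabilityTheory

open Filter Topology

/-- Two Borel probability measures are equal if they integrate all bounded Lipschitz functions
equally. -/
theorem measure_ext_of_forall_lipschitz_integral_eq {Ω : Type*} [MeasurableSpace Ω]
    [PseudoMetricSpace Ω] [BorelSpace Ω] {μ ν : Measure Ω} [IsProbabilityMeasure μ]
    [IsProbabilityMeasure ν]
    (h : ∀ (K : NNReal) (f : Ω → ℝ), LipschitzWith K f → (∃ M : ℝ, ∀ x, |f x| ≤ M) →
      ∫ x, f x ∂μ = ∫ x, f x ∂ν) :
    μ = ν := by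
  let μ' : ProbabilityMeasure Ω := ⟨μ, inferInstance⟩
  let ν' : ProbabilityMeasure Ω := ⟨ν, inferInstance⟩
  have key : Tendsto (fun _ : ℕ ↦ μ') atTop (𝓝 ν') := by
    rw [tendsto_iff_forall_lipschitz_integral_tendsto]
    intro f ⟨B, hB⟩ ⟨K, hK⟩
    have hbdd : ∃ M : ℝ, ∀ x, |f x| ≤ M := by
      by_cases hne : Nonempty Ω
      · obtain ⟨x₀⟩ := hne
        refine ⟨B + |f x₀|, fun x ↦ ?_⟩
        have h₁ := hB x x₀
        rw [Real.dist_eq] at h₁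
        linarith [abs_sub_abs_le_abs_sub (f x) (f x₀)]
      · exact ⟨0, fun x ↦ (hne ⟨x⟩).elim⟩
    change Tendsto (fun _ ↦ ∫ x, f x ∂μ) atTop (𝓝 (∫ x, f x ∂ν))
    rw [h K f hK hbdd]
    exact tendsto_const_nhds
  have heq : μ' = ν' := tendsto_nhds_unique tendsto_const_nhds key
  exact congrArg Subtype.val heq

/-- If the family of Markov kernels `(P_{s,t})_{s ≤ t}` is `τ`-periodic
(`P_{s+τ,t+τ} = P_{s,t}`), and `(μ_t)` is an evolution system of probability measures with
uniformly bounded first moments satisfying the convergence estimate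
`|P_{s,t}φ(y) - μ_t(φ)| ≤ C Lip(φ) (1+‖y‖) e^{-a(t-s)}` for all bounded Lipschitz `φ`,
then the evolution system is `τ`-periodic: `μ_{t+τ} = μ_t` for all `t`. -/
theorem stmt_14 {H : Type*} [NormedAddCommGroup H] [InnerProductSpace ℝ H]
    [CompleteSpace H] [SecondCountableTopology H] [MeasurableSpace H] [BorelSpace H]
    (τ : ℝ) (hτ : 0 < τ)
    (P : ℝ → ℝ → Kernel H H) (hP : ∀ s t : ℝ, IsMarkovKernel (P s t))
    (hPper : ∀ s t : ℝ, s ≤ t → P (s + τ) (t + τ) = P s t)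
    (μ : ℝ → Measure H) (hμprob : ∀ t : ℝ, IsProbabilityMeasure (μ t))
    (hμ : IsEvolutionSystemOfMeasures P μ)
    (hmom : (⨆ t : ℝ, ∫⁻ y, ‖y‖₊ ∂(μ t)) < ⊤)
    (C a : ℝ) (hC : 0 ≤ C) (ha : 0 < a)
    (hconv : ∀ (K : NNReal) (φ : H → ℝ), LipschitzWith K φ → (∃ M : ℝ, ∀ z, |φ z| ≤ M) →
      ∀ s t : ℝ, s ≤ t → ∀ y : H,
        |(∫ z, φ z ∂(P s t y)) - ∫ z, φ z ∂(μ t)|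
          ≤ C * (K : ℝ) * (1 + ‖y‖) * Real.exp (-a * (t - s))) :
    ∀ t : ℝ, μ (t + τ) = μ t := by
  intro t
  have hint : ∀ (K : NNReal) (φ : H → ℝ), LipschitzWith K φ → (∃ M : ℝ, ∀ z, |φ z| ≤ M) →
      ∀ u : ℝ, Tendsto (fun n : ℕ ↦ ∫ z, φ z ∂(P (u - n) u 0)) atTop (𝓝 (∫ z, φ z ∂(μ u))) := by
    intro K φ hφ hbdd u
    rw [tendsto_iff_dist_tendsto_zero]
    have hexp : Tendsto (fun n : ℕ ↦ C * (K : ℝ) * Real.exp (-(a * n))) atTop (𝓝 0) := by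
      simpa using (Real.tendsto_exp_neg_atTop_nhds_zero.comp
        (tendsto_natCast_atTop_atTop.const_mul_atTop ha)).const_mul (C * (K : ℝ))
    refine squeeze_zero (fun _ ↦ dist_nonneg) (fun n ↦ ?_) hexp
    simpa [Real.dist_eq] using hconv K φ hφ hbdd (u - n) u (by simp) 0
  refine measure_ext_of_forall_lipschitz_integral_eq fun K φ hφ hbdd ↦ ?_
  refine tendsto_nhds_unique (hint K φ hφ hbdd (t + τ)) ?_
  refine (hint K φ hφ hbdd t).congr fun n ↦ ?_
  rw [← hPper (t - n) t (by simp), sub_add_eq_add_sub]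
end

section
/- Let H be a separable real Hilbert space. Let F̃ : H × H → H satisfy ‖F̃(x₁,y₁) − F̃(x₂,y₂)‖ ≤ C(‖x₁−x₂‖ + ‖y₁−y₂‖) for all x₁,x₂,y₁,y₂ ∈ H and some C ≥ 0, and let (μ^x)_{x ∈ H} be a family of Borel probability measures on H such that ∫_H ‖y‖ μ^x(dy) < ∞ for every x ∈ H and such that for every Lipschitz function φ : H → ℝ and all x₁, x₂ ∈ H, | ∫_H φ(y) μ^{x₁}(dy) − ∫_H φ(y) μ^{x₂}(dy) | ≤ K · Lip(φ) · ‖x₁ − x₂‖ for some K ≥ 0. Then the averaged map F̄(x) := ∫_H F̃(x,y) μ^x(dy) is well defined (the integrand is Bochner integrable) and is Lipschitz continuous with ‖F̄(x₁) − F̄(x₂)‖ ≤ C(1 + K) ‖x₁ − x₂‖ for all x₁, x₂ ∈ H. -/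
open MeasureTheory

theorem LipschitzWith.integrable_of_integrable_norm {E G : Type*} [NormedAddCommGroup E]
    [SecondCountableTopology E] [MeasurableSpace E] [BorelSpace E] [NormedAddCommGroup G]
    {L : NNReal} {f : E → G} (hf : LipschitzWith L f) {μ : Measure E} [IsFiniteMeasure μ]
    (hμ : Integrable (fun y => ‖y‖) μ) : Integrable f μ := by
  refine ((integrable_const ‖f 0‖).add (hμ.const_mul (L : ℝ))).mono'
    hf.continuous.aestronglyMeasurable (Filter.Eventually.of_forall fun y => ?_)
  have h := hf.norm_sub_le y 0
  rw [sub_zero] at h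
  have h' := norm_sub_norm_le (f y) (f 0)
  simp only [Pi.add_apply]
  linarith

/-- Bounds on differences of integrals of real Lipschitz functions extend to Lipschitz functions
with values in a Hilbert space, with the same constant. -/
theorem norm_integral_sub_integral_le_of_lipschitzWith {E G : Type*} [PseudoMetricSpace E]
    [MeasurableSpace E] [NormedAddCommGroup G] [InnerProductSpace ℝ G] [CompleteSpace G]
    {μ ν : Measure E} {d : ℝ} (hd : 0 ≤ d)
    (h : ∀ (L : NNReal) (φ : E → ℝ), LipschitzWith L φ →
      |(∫ y, φ y ∂μ) - ∫ y, φ y ∂ν| ≤ L * d)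
    {L : NNReal} {f : E → G} (hf : LipschitzWith L f) (hμ : Integrable f μ)
    (hν : Integrable f ν) : ‖(∫ y, f y ∂μ) - ∫ y, f y ∂ν‖ ≤ L * d := by
  set v := (∫ y, f y ∂μ) - ∫ y, f y ∂ν with hv
  have hφ : LipschitzWith (‖v‖₊ * L) fun y => inner ℝ v (f y) := by
    refine LipschitzWith.of_dist_le_mul fun y z => ?_
    rw [Real.dist_eq, ← inner_sub_right, NNReal.coe_mul, coe_nnnorm, mul_assoc]
    refine (abs_real_inner_le_norm _ _).trans ?_
    gcongr
    rw [← dist_eq_norm]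
    exact hf.dist_le_mul y z
  have key := h _ _ hφ
  rw [integral_inner hμ, integral_inner hν, ← inner_sub_right, ← hv,
    real_inner_self_eq_norm_mul_norm, abs_of_nonneg (by positivity), NNReal.coe_mul,
    coe_nnnorm, mul_assoc] at key
  rcases (norm_nonneg v).eq_or_lt with h0 | h0
  · rw [← h0]
    positivity
  · exact le_of_mul_le_mul_left key h0

/-- Let `H` be a separable real Hilbert space, `F̃ : H × H → H` jointly
Lipschitz with constant `C`, and `(μ^x)_{x ∈ H}` a family of Borel probability measures with
finite first moments depending Lipschitz-continuously on `x` in the sense that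
`|μ^{x₁}(φ) - μ^{x₂}(φ)| ≤ K Lip(φ) ‖x₁ - x₂‖` for all Lipschitz `φ : H → ℝ`. Then the
averaged map `F̄(x) = ∫ F̃(x,y) μ^x(dy)` is well defined (the integrand is Bochner
integrable) and satisfies `‖F̄(x₁) - F̄(x₂)‖ ≤ C(1+K)‖x₁ - x₂‖`. -/
theorem stmt_15 {H : Type*} [NormedAddCommGroup H] [InnerProductSpace ℝ H]
    [CompleteSpace H] [SecondCountableTopology H] [MeasurableSpace H] [BorelSpace H]
    (F : H → H → H) (C : ℝ) (hC : 0 ≤ C)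
    (hF : ∀ x₁ x₂ y₁ y₂ : H, ‖F x₁ y₁ - F x₂ y₂‖ ≤ C * (‖x₁ - x₂‖ + ‖y₁ - y₂‖))
    (μ : H → Measure H) (hμprob : ∀ x, IsProbabilityMeasure (μ x))
    (hmom : ∀ x, (∫⁻ y, ‖y‖₊ ∂(μ x)) < ⊤)
    (K : ℝ) (hK : 0 ≤ K)
    (hlip : ∀ (Kφ : NNReal) (φ : H → ℝ), LipschitzWith Kφ φ →
      ∀ x₁ x₂ : H, |(∫ y, φ y ∂(μ x₁)) - ∫ y, φ y ∂(μ x₂)| ≤ K * (Kφ : ℝ) * ‖x₁ - x₂‖) :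
    (∀ x, Integrable (fun y => F x y) (μ x)) ∧
      ∀ x₁ x₂ : H, ‖(∫ y, F x₁ y ∂(μ x₁)) - ∫ y, F x₂ y ∂(μ x₂)‖
        ≤ C * (1 + K) * ‖x₁ - x₂‖ := by
  lift C to NNReal using hC
  have hFlip : ∀ x, LipschitzWith C (F x) := fun x =>
    LipschitzWith.of_dist_le_mul fun y z => by
      simpa [dist_eq_norm] using hF x x y z
  have hnorm : ∀ x, Integrable (fun y => ‖y‖) (μ x) := fun x =>
    Integrable.norm ⟨continuous_id.aestronglyMeasurable, hmom x⟩
  have hint : ∀ x x', Integrable (F x) (μ x') := fun x x' =>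
    (hFlip x).integrable_of_integrable_norm (hnorm x')
  refine ⟨fun x => hint x x, fun x₁ x₂ => ?_⟩
  have hslow : ‖(∫ y, F x₁ y ∂(μ x₁)) - ∫ y, F x₂ y ∂(μ x₁)‖ ≤ C * ‖x₁ - x₂‖ := by
    rw [← integral_sub (hint _ _) (hint _ _)]
    have h := norm_integral_le_of_norm_le_const (μ := μ x₁)
      (f := fun y => F x₁ y - F x₂ y) (C := C * ‖x₁ - x₂‖)
      (Filter.Eventually.of_forall fun y => by simpa using hF x₁ x₂ y y)
    simpa using h
  have hmeas : ‖(∫ y, F x₂ y ∂(μ x₁)) - ∫ y, F x₂ y ∂(μ x₂)‖ ≤ C * (K * ‖x₁ - x₂‖) :=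
    norm_integral_sub_integral_le_of_lipschitzWith (by positivity)
      (fun L φ hφ => (hlip L φ hφ x₁ x₂).trans_eq (by ring)) (hFlip x₂) (hint _ _) (hint _ _)
  calc _ ≤ _ := norm_sub_le_norm_sub_add_norm_sub _ (∫ y, F x₂ y ∂(μ x₁)) _
    _ ≤ _ := add_le_add hslow hmeas
    _ = _ := by ring
end
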